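/- There exists a constant C > 0 such that for every δ ≥ 1, every C_G, A > 0, every function f of Gevrey class G^δ([−1,1], C_G, A), every integer m ≥ 3 and every integer k with 2 ≤ k ≤ m − 1, there is a real polynomial p of degree at most m with ‖f − p‖_{H²([−1,1])} ≤ C · C_G · A^{k+2} · ((k+2)!)^δ · ((m−1−k)!/(m−1+k)!)^{1/2}. -/

import Mathlib

/-- `f : ℝ → ℝ` is of Gevrey class `G^δ([a,b], C_G, A)`: it is `C^∞` on a
neighborhood of `[a,b]` and satisfies `|f⁽ⁿ⁾(x)| ≤ C_G·Aⁿ·(n!)^δ` on `[a,b]`. -/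
def GevreyOn (a b δ CG A : ℝ) (f : ℝ → ℝ) : Prop :=
  (∃ U : Set ℝ, IsOpen U ∧ Set.Icc a b ⊆ U ∧ ContDiffOn ℝ (⊤ : ℕ∞) f U) ∧
    ∀ n : ℕ, ∀ x ∈ Set.Icc a b,
      |iteratedDeriv n f x| ≤ CG * A ^ n * (n.factorial : ℝ) ^ δ

/-- The `H²([-1,1])` norm
`‖u‖ = (‖u‖²_{L²} + ‖u′‖²_{L²} + ‖u″‖²_{L²})^{1/2}`. -/
noncomputable def H2norm (u : ℝ → ℝ) : ℝ :=
  Real.sqrt ((∫ x in (-1 : ℝ)..1, u x ^ 2) +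
    (∫ x in (-1 : ℝ)..1, deriv u x ^ 2) +
    (∫ x in (-1 : ℝ)..1, deriv (deriv u) x ^ 2))

/-- Orthogonal projection onto a finite-dimensional subspace for a definite bilinear form. -/
lemma exists_orthogonal_decomposition {V : Type*} [AddCommGroup V] [Module ℝ V]
    (B : LinearMap.BilinForm ℝ V) (hdef : ∀ x, B x x = 0 → x = 0) (W : Submodule ℝ V)
    [FiniteDimensional ℝ W] (p : V) :
    ∃ r ∈ W, ∀ s ∈ W, B (p - r) s = 0 := by
  have hinj : Function.Injective (B.restrict W) := by
    rw [injective_iff_map_eq_zero]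
    intro x hx
    have h : B.restrict W x x = 0 := by rw [hx]; rfl
    exact Subtype.ext (hdef x h)
  have hsurj := (LinearMap.injective_iff_surjective_of_finrank_eq_finrank
    (Subspace.dual_finrank_eq (K := ℝ) (V := W)).symm).1 hinj
  obtain ⟨r, hr⟩ := hsurj ((B p).domRestrict W)
  refine ⟨r, r.2, fun s hs => ?_⟩
  have h : B r s = B p s := LinearMap.congr_fun hr ⟨s, hs⟩
  rw [map_sub, LinearMap.sub_apply, h, sub_self]

open Polynomial in
/-- Integration over `[-1,1]` as a linear functional on real polynomials. -/
noncomputable def polyIntegral : ℝ[X] →ₗ[ℝ] ℝ where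
  toFun p := ∫ x in (-1 : ℝ)..1, p.eval x
  map_add' p q := by
    simp only [eval_add]
    exact intervalIntegral.integral_add (p.continuous.intervalIntegrable _ _)
      (q.continuous.intervalIntegrable _ _)
  map_smul' c p := by
    simp [eval_smul]

namespace polyIntegral

open Polynomial

lemma apply_def (p : ℝ[X]) : polyIntegral p = ∫ x in (-1 : ℝ)..1, p.eval x := rfl

lemma mono {p q : ℝ[X]} (h : ∀ x ∈ Set.Icc (-1 : ℝ) 1, p.eval x ≤ q.eval x) :
    polyIntegral p ≤ polyIntegral q :=
  intervalIntegral.integral_mono_on (by norm_num) (p.continuous.intervalIntegrable _ _)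
    (q.continuous.intervalIntegrable _ _) h

lemma nonneg {p : ℝ[X]} (h : ∀ x ∈ Set.Icc (-1 : ℝ) 1, 0 ≤ p.eval x) :
    0 ≤ polyIntegral p := by
  simpa using mono (p := 0) (q := p) (by simpa using h)

lemma derivative_eq (p : ℝ[X]) :
    polyIntegral (derivative p) = p.eval 1 - p.eval (-1) :=
  intervalIntegral.integral_eq_sub_of_hasDerivAt (fun x _ => p.hasDerivAt x)
    ((derivative p).continuous.intervalIntegrable _ _)

lemma one_sub_sq_nonneg {x : ℝ} (hx : x ∈ Set.Icc (-1 : ℝ) 1) : 0 ≤ 1 - x ^ 2 := by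
  nlinarith [hx.1, hx.2]

lemma weighted_sq_nonneg (j : ℕ) (p : ℝ[X]) :
    0 ≤ polyIntegral ((1 - X ^ 2) ^ j * p * p) := by
  refine nonneg fun x hx => ?_
  have := one_sub_sq_nonneg hx
  simp only [eval_mul, eval_pow, eval_sub, eval_one, eval_X, mul_assoc]
  positivity [mul_self_nonneg (p.eval x)]

lemma weighted_sq_eq_zero {j : ℕ} {p : ℝ[X]}
    (h : polyIntegral ((1 - X ^ 2) ^ j * p * p) = 0) : p = 0 := by
  by_contra hp
  obtain ⟨c, hc, hcp⟩ : ∃ c ∈ Set.Ioo (-1 : ℝ) 1, p.eval c ≠ 0 := by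
    by_contra! hall
    refine hp (p.eq_zero_of_infinite_isRoot ((Set.Ioo_infinite (by norm_num)).mono hall))
  refine absurd h (ne_of_gt ?_)
  refine intervalIntegral.integral_pos (by norm_num) (Polynomial.continuous _).continuousOn
    (fun x hx => ?_) ⟨c, Set.Ioo_subset_Icc_self hc, ?_⟩
  · have := one_sub_sq_nonneg (Set.Ioc_subset_Icc_self hx)
    simp only [eval_mul, eval_pow, eval_sub, eval_one, eval_X, mul_assoc]
    exact mul_nonneg (pow_nonneg this _) (mul_self_nonneg _)
  · have : 0 < 1 - c ^ 2 := by nlinarith [hc.1, hc.2]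
    simp only [eval_mul, eval_pow, eval_sub, eval_one, eval_X, mul_assoc]
    exact mul_pos (pow_pos this _) (mul_self_pos.2 hcp)

/-- The `L²` inner product on `[-1,1]` with the Gegenbauer weight `(1 - x²)^j`. -/
noncomputable def weighted (j : ℕ) : LinearMap.BilinForm ℝ ℝ[X] :=
  (LinearMap.mul ℝ ℝ[X]).compr₂ (polyIntegral ∘ₗ LinearMap.mulLeft ℝ ((1 - X ^ 2) ^ j))

lemma weighted_apply (j : ℕ) (p q : ℝ[X]) :
    weighted j p q = polyIntegral ((1 - X ^ 2) ^ j * p * q) := by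
  simp [weighted, mul_assoc]

lemma weighted_comm (j : ℕ) (p q : ℝ[X]) : weighted j p q = weighted j q p := by
  rw [weighted_apply, weighted_apply, mul_right_comm]

lemma weighted_self_nonneg (j : ℕ) (p : ℝ[X]) : 0 ≤ weighted j p p := by
  rw [weighted_apply]; exact weighted_sq_nonneg j p

lemma eq_zero_of_weighted_self {j : ℕ} {p : ℝ[X]} (h : weighted j p p = 0) : p = 0 :=
  weighted_sq_eq_zero ((weighted_apply j p p).symm.trans h)

lemma exists_projection (j n : ℕ) (p : ℝ[X]) :
    ∃ r : ℝ[X], r.degree < n ∧ ∀ s : ℝ[X], s.degree < n → weighted j (p - r) s = 0 := by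
  have : FiniteDimensional ℝ (degreeLT ℝ n) :=
    (degreeLTEquiv ℝ n).symm.finiteDimensional
  obtain ⟨r, hr, h⟩ := exists_orthogonal_decomposition (weighted j)
    (fun _ => eq_zero_of_weighted_self) (degreeLT ℝ n) p
  exact ⟨r, mem_degreeLT.1 hr, fun s hs => h s (mem_degreeLT.2 hs)⟩

/-- The Gegenbauer operator `p ↦ 2(j+1) x dp/dx - (1-x²) d²p/dx²`. -/
noncomputable def gegenbauerOp (j : ℕ) (p : ℝ[X]) : ℝ[X] :=
  C (2 * ((j : ℝ) + 1)) * (X * derivative p) - (1 - X ^ 2) * derivative (derivative p)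

lemma weighted_derivative_aux (j : ℕ) (p q : ℝ[X]) :
    weighted (j + 1) (derivative p) q +
      weighted j p ((1 - X ^ 2) * derivative q - C (2 * ((j : ℝ) + 1)) * (X * q)) = 0 := by
  have h := derivative_eq ((1 - X ^ 2) ^ (j + 1) * p * q)
  simp only [eval_mul, eval_pow, eval_sub, eval_one, eval_X] at h
  rw [weighted_apply, weighted_apply, ← map_add]
  trans polyIntegral (derivative ((1 - X ^ 2) ^ (j + 1) * p * q))
  · congr 1
    simp [derivative_pow]
    ring
  · rw [h]; norm_num

lemma weighted_gegenbauerOp (j : ℕ) (p q : ℝ[X]) :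
    weighted j (gegenbauerOp j p) q = weighted (j + 1) (derivative p) (derivative q) := by
  have h := weighted_derivative_aux j q (derivative p)
  rw [weighted_comm (j + 1), weighted_comm j] at h
  have e : gegenbauerOp j p = -((1 - X ^ 2) * derivative (derivative p) -
      C (2 * ((j : ℝ) + 1)) * (X * derivative p)) := by
    rw [gegenbauerOp]; ring
  rw [e, map_neg, LinearMap.neg_apply]
  linarith

lemma coeff_X_mul_derivative (p : ℝ[X]) (e : ℕ) :
    (X * derivative p).coeff e = e * p.coeff e := by
  cases e with
  | zero => simp
  | succ e => rw [coeff_X_mul, coeff_derivative]; push_cast; ring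

lemma degree_gegenbauerOp_sub_lt (j d : ℕ) {p : ℝ[X]} (hp : p.degree < (d + 1 : ℕ)) :
    (gegenbauerOp j p - C ((d : ℝ) * (d + 2 * j + 1)) * p).degree < d := by
  rw [degree_lt_iff_coeff_zero] at hp ⊢
  intro e he
  have h1 : gegenbauerOp j p - C ((d : ℝ) * (d + 2 * j + 1)) * p =
      C (2 * (j : ℝ) + 1) * (X * derivative p) + X * derivative (X * derivative p)
        - derivative (derivative p) - C ((d : ℝ) * (d + 2 * j + 1)) * p := by
    have : C (2 * ((j : ℝ) + 1)) = C (2 * (j : ℝ) + 1) + 1 := by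
      rw [← C_1, ← C_add]; congr 1; ring
    simp only [gegenbauerOp, this, derivative_mul, derivative_X]
    ring
  rw [h1]
  simp only [coeff_sub, coeff_add, coeff_C_mul, coeff_X_mul_derivative, coeff_derivative]
  rw [hp (e + 1 + 1) (by omega)]
  rcases he.eq_or_lt with rfl | h
  · ring
  · rw [hp e (by omega)]; ring

/-- Weighted Poincaré inequality on the orthogonal complement of the polynomials of degree
less than `n`. -/
lemma poincare (j n : ℕ) (p : ℝ[X])
    (hp : ∀ s : ℝ[X], s.degree < n → weighted j p s = 0) :
    (n : ℝ) * (n + 2 * j + 1) * weighted j p p ≤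
      weighted (j + 1) (derivative p) (derivative p) := by
  obtain ⟨d, hd⟩ : ∃ d : ℕ, p.degree < d :=
    ⟨p.natDegree + 1, degree_le_natDegree.trans_lt (by exact_mod_cast Nat.lt_succ_self _)⟩
  induction d generalizing p with
  | zero =>
    have : p = 0 := by simpa [Nat.WithBot.lt_zero_iff] using hd
    simp [this]
  | succ d ih =>
    rcases lt_or_ge d n with hdn | hnd
    · have : p = 0 := eq_zero_of_weighted_self
        (hp p (hd.trans_le (by exact_mod_cast hdn)))
      simp [this]
    · obtain ⟨r, hr, hq⟩ := exists_projection j d p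
      obtain ⟨q, rfl⟩ : ∃ q, p = q + r := ⟨p - r, by ring⟩
      rw [add_sub_cancel_right] at hq
      have hlt : ∀ {s : ℝ[X]}, s.degree < d → s.degree < (d + 1 : ℕ) := fun hs =>
        hs.trans (by exact_mod_cast Nat.lt_succ_self d)
      have hqd : q.degree < (d + 1 : ℕ) := by
        have := (degree_sub_le (q + r) r).trans_lt (max_lt hd (hlt hr))
        rwa [add_sub_cancel_right] at this
      have hrn : ∀ s : ℝ[X], s.degree < n → weighted j r s = 0 := fun s hs => by
        have h1 := hp s hs
        rw [map_add, LinearMap.add_apply, hq s (hs.trans_le (by exact_mod_cast hnd))] at h1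
        simpa using h1
      set lam : ℝ := (d : ℝ) * (d + 2 * j + 1) with hlam
      have hcd := degree_gegenbauerOp_sub_lt j d hqd
      have hop_orth : ∀ s : ℝ[X], s.degree < d → weighted j (gegenbauerOp j q) s = 0 := by
        intro s hs
        rw [weighted_gegenbauerOp, weighted_comm, ← weighted_gegenbauerOp, weighted_comm]
        apply hq
        have h2 := degree_gegenbauerOp_sub_lt j d (hlt hs)
        have h3 : gegenbauerOp j s = (gegenbauerOp j s - C lam * s) + C lam * s := by ring
        rw [h3]
        refine (degree_add_le _ _).trans_lt (max_lt h2 ?_)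
        exact by rw [← smul_eq_C_mul]; exact (degree_smul_le _ _).trans_lt hs
      have heig : gegenbauerOp j q = lam • q := by
        rw [← sub_eq_zero]
        rw [← smul_eq_C_mul] at hcd
        apply eq_zero_of_weighted_self (j := j)
        have e : ∀ s : ℝ[X], weighted j (gegenbauerOp j q - lam • q) s =
            weighted j (gegenbauerOp j q) s - lam * weighted j q s := fun s => by simp
        rw [e, hop_orth _ hcd, hq _ hcd]
        simp
      have hqr := hq r hr
      have hrq := (weighted_comm j r q).trans hqr
      have key := ih r hrn hr
      have e1 : weighted (j + 1) (derivative q) (derivative q) = lam * weighted j q q := by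
        rw [← weighted_gegenbauerOp, heig]; simp
      have e2 : weighted (j + 1) (derivative q) (derivative r) = 0 := by
        rw [← weighted_gegenbauerOp, heig]; simp [hqr]
      have e3 := (weighted_comm (j + 1) (derivative r) (derivative q)).trans e2
      have hl : (n : ℝ) * (n + 2 * j + 1) ≤ lam := by
        have : (n : ℝ) ≤ d := by exact_mod_cast hnd
        rw [hlam]; gcongr
      have := mul_le_mul_of_nonneg_right hl (weighted_self_nonneg j q)
      simp only [map_add, LinearMap.add_apply, e1, e2, e3, hqr, hrq]
      linarith

lemma weighted_derivative_orthogonal {j n : ℕ} {p : ℝ[X]}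
    (hp : ∀ s : ℝ[X], s.degree < (n + 1 : ℕ) → weighted j p s = 0) :
    ∀ s : ℝ[X], s.degree < n → weighted (j + 1) (derivative p) s = 0 := by
  intro s hs
  have h := weighted_derivative_aux j p s
  rwa [hp, add_zero] at h
  rw [degree_lt_iff_coeff_zero] at hs ⊢
  intro e he
  obtain ⟨e, rfl⟩ : ∃ e', e = e' + 1 := ⟨e - 1, by omega⟩
  have h1 : (1 - X ^ 2) * derivative s - C (2 * ((j : ℝ) + 1)) * (X * s) =
      derivative s - X * (X * derivative s) - C (2 * ((j : ℝ) + 1)) * (X * s) := by ring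
  rw [h1]
  simp only [coeff_sub, coeff_C_mul, coeff_X_mul, coeff_X_mul_derivative, coeff_derivative]
  rw [hs e (by omega), hs (e + 1 + 1) (by omega)]
  ring

lemma iterate_derivative_orthogonal {n : ℕ} {p : ℝ[X]}
    (hp : ∀ s : ℝ[X], s.degree < n → weighted 0 p s = 0) (k : ℕ) (hk : k ≤ n) :
    ∀ s : ℝ[X], s.degree < (n - k : ℕ) → weighted k (derivative^[k] p) s = 0 := by
  induction k with
  | zero => simpa using hp
  | succ k ih =>
    rw [Function.iterate_succ_apply']
    refine weighted_derivative_orthogonal ?_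
    rw [show n - (k + 1) + 1 = n - k by omega]
    exact ih (by omega)

lemma weighted_zero_le {n : ℕ} {p : ℝ[X]}
    (hp : ∀ s : ℝ[X], s.degree < n → weighted 0 p s = 0) (k : ℕ) (hk : k ≤ n) :
    weighted 0 p p ≤ ((n - k).factorial : ℝ) / ((n + k).factorial : ℝ) *
      weighted k (derivative^[k] p) (derivative^[k] p) := by
  induction k with
  | zero => simp [div_self, Nat.factorial_ne_zero]
  | succ k ih =>
    refine (ih (by omega)).trans ?_
    have h := poincare k (n - k) _ (iterate_derivative_orthogonal hp k (by omega))
    rw [← Function.iterate_succ_apply' (f := derivative)] at h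
    have hpos : (0 : ℝ) < ((n - k : ℕ) : ℝ) := by exact_mod_cast (by omega : 0 < n - k)
    have e1 : ((n - k).factorial : ℝ) =
        ((n - k : ℕ) : ℝ) * ((n - (k + 1)).factorial : ℝ) := by
      rw [show n - k = (n - (k + 1)) + 1 by omega, Nat.factorial_succ]; push_cast; ring
    have e2 : ((n + (k + 1)).factorial : ℝ) =
        (((n - k : ℕ) : ℝ) + 2 * k + 1) * ((n + k).factorial : ℝ) := by
      rw [← add_assoc, Nat.factorial_succ, Nat.cast_sub (by omega)]; push_cast; ring
    have hden : (0 : ℝ) < ((n - k : ℕ) : ℝ) + 2 * k + 1 := by positivity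
    have hf : (0 : ℝ) < ((n + k).factorial : ℝ) := by positivity
    rw [e1, e2]
    refine le_trans (le_of_eq ?_) (mul_le_mul_of_nonneg_left h (by positivity))
    field_simp

/-- Weighted best approximation estimate for a polynomial in `L²([-1,1])`. -/
lemma exists_approx (g : ℝ[X]) (n k : ℕ) (hk : k ≤ n) :
    ∃ q : ℝ[X], q.degree < n ∧ polyIntegral ((g - q) ^ 2) ≤
      ((n - k).factorial : ℝ) / ((n + k).factorial : ℝ) *
        weighted k (derivative^[k] g) (derivative^[k] g) := by
  obtain ⟨q, hq, horth⟩ := exists_projection 0 n g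
  refine ⟨q, hq, ?_⟩
  have h := weighted_zero_le horth k hk
  rw [weighted_apply, pow_zero, one_mul, ← pow_two] at h
  refine h.trans (mul_le_mul_of_nonneg_left ?_ (by positivity))
  set v := g - q with hv
  have hg : g = v + q := by rw [hv]; ring
  have hqk : (derivative^[k] q).degree < (n - k : ℕ) := by
    rw [degree_lt_iff_coeff_zero] at hq ⊢
    intro e he
    rw [coeff_iterate_derivative, hq (e + k) (by omega), smul_zero]
  have h0 := iterate_derivative_orthogonal horth k hk _ hqk
  have h1 := (weighted_comm k (derivative^[k] q) (derivative^[k] v)).trans h0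
  have hadd : derivative^[k] g = derivative^[k] v + derivative^[k] q := by
    rw [hg]; exact iterate_map_add derivative k v q
  rw [hadd]
  simp only [map_add, LinearMap.add_apply, h0, h1]
  linarith [weighted_self_nonneg k (derivative^[k] q)]

lemma weighted_self_le {k : ℕ} {p : ℝ[X]} {M : ℝ}
    (h : ∀ x ∈ Set.Icc (-1 : ℝ) 1, |p.eval x| ≤ M) : weighted k p p ≤ 2 * M ^ 2 := by
  have e : polyIntegral (C (M ^ 2)) = 2 * M ^ 2 := by
    rw [apply_def]; simp; norm_num
  rw [weighted_apply, ← e]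
  refine mono fun x hx => ?_
  have h0 := one_sub_sq_nonneg hx
  have h1 : (1 - x ^ 2) ^ k ≤ 1 := pow_le_one₀ h0 (by nlinarith [sq_nonneg x])
  have h2 : p.eval x * p.eval x ≤ M ^ 2 := by
    rw [← pow_two, ← sq_abs]; gcongr; exact h x hx
  simp only [eval_mul, eval_pow, eval_sub, eval_one, eval_X, eval_C, mul_assoc]
  nlinarith [mul_self_nonneg (p.eval x), pow_nonneg h0 k]

lemma sq_le_derivative_sq {p : ℝ[X]} (h : p.eval (-1) = 0) :
    polyIntegral (p ^ 2) ≤ 16 * polyIntegral (derivative p ^ 2) := by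
  have h0 := derivative_eq ((X - 1) * p ^ 2)
  simp only [eval_mul, eval_pow, eval_sub, eval_one, eval_X, h] at h0
  norm_num at h0
  have h1 : polyIntegral (p ^ 2) ≤ polyIntegral ((2 : ℝ) • derivative ((X - 1) * p ^ 2) +
      (16 : ℝ) • derivative p ^ 2) := by
    refine mono fun x hx => ?_
    simp [derivative_pow]
    set a := p.eval x
    set b := (derivative p).eval x
    have h2 : (1 - x) ^ 2 ≤ 4 := by nlinarith [hx.1, hx.2]
    nlinarith [sq_nonneg (a - 2 * (1 - x) * b), mul_le_mul_of_nonneg_right h2 (sq_nonneg b)]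
  rw [map_add, map_smul, map_smul] at h1
  simp [derivative_pow] at h0 h1
  rw [h0] at h1
  linarith

lemma exists_antiderivative (q : ℝ[X]) (c : ℝ) :
    ∃ p : ℝ[X], derivative p = q ∧ p.eval (-1) = c := by
  obtain ⟨p, hp⟩ : ∃ p : ℝ[X], derivative p = q := by
    induction q using Polynomial.induction_on' with
    | add a b ha hb =>
      obtain ⟨a', rfl⟩ := ha
      obtain ⟨b', rfl⟩ := hb
      exact ⟨a' + b', derivative_add⟩
    | monomial n a =>
      refine ⟨monomial (n + 1) (a / (n + 1)), ?_⟩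
      have : (n : ℝ) + 1 ≠ 0 := by positivity
      rw [derivative_monomial]
      push_cast
      rw [div_mul_cancel₀ _ this]
  exact ⟨p + C (c - p.eval (-1)), by simp [hp], by simp⟩

lemma degree_lt_of_derivative {p : ℝ[X]} {n : ℕ} (h : (derivative p).degree < n) :
    p.degree < (n + 1 : ℕ) := by
  rw [degree_lt_iff_coeff_zero] at h ⊢
  intro e he
  obtain ⟨e, rfl⟩ : ∃ e', e = e' + 1 := ⟨e - 1, by omega⟩
  have h1 := h e (by omega)
  rw [coeff_derivative] at h1
  exact (mul_eq_zero.1 h1).resolve_right (by positivity)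

end polyIntegral

open Polynomial in
/-- Weierstrass approximation of a smooth function on `[-1,1]` together with finitely many
derivatives. -/
lemma exists_polynomial_near_iteratedDeriv {U : Set ℝ} (hU : IsOpen U)
    (hsub : Set.Icc (-1 : ℝ) 1 ⊆ U) (n : ℕ) {f : ℝ → ℝ} (hf : ContDiffOn ℝ (⊤ : ℕ∞) f U)
    {ε : ℝ} (hε : 0 < ε) :
    ∃ p : ℝ[X], ∀ i ≤ n, ∀ x ∈ Set.Icc (-1 : ℝ) 1,
      |iteratedDeriv i f x - (derivative^[i] p).eval x| ≤ ε := by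
  induction n generalizing f ε with
  | zero =>
    obtain ⟨p, hp⟩ := exists_polynomial_near_of_continuousOn (-1) 1 f
      (hf.continuousOn.mono hsub) ε hε
    refine ⟨p, fun i hi x hx => ?_⟩
    obtain rfl : i = 0 := by omega
    rw [iteratedDeriv_zero, Function.iterate_zero_apply, abs_sub_comm]
    exact (hp x hx).le
  | succ n ih =>
    have hf' : ContDiffOn ℝ (⊤ : ℕ∞) (deriv f) U :=
      hf.deriv_of_isOpen hU (by simp)
    obtain ⟨q, hq⟩ := ih hf' (half_pos hε)
    obtain ⟨p, rfl, hp⟩ := polyIntegral.exists_antiderivative q (f (-1))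
    refine ⟨p, fun i hi x hx => ?_⟩
    cases i with
    | succ i =>
      rw [iteratedDeriv_succ', Function.iterate_succ_apply]
      exact (hq i (by omega) x hx).trans (by linarith)
    | zero =>
      have hd : ∀ y ∈ Set.Icc (-1 : ℝ) 1, HasDerivWithinAt (fun y => f y - p.eval y)
          (deriv f y - (derivative p).eval y) (Set.Icc (-1) 1) y := fun y hy =>
        ((((hf.contDiffAt (hU.mem_nhds (hsub hy))).differentiableAt
          (by simp)).hasDerivAt).sub (p.hasDerivAt y)).hasDerivWithinAt
      have h := (convex_Icc (-1 : ℝ) 1).norm_image_sub_le_of_norm_hasDerivWithin_le hd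
        (fun y hy => by simpa using hq 0 (by omega) y hy)
        (Set.left_mem_Icc.2 (by norm_num)) hx
      rw [hp, sub_self, sub_zero, Real.norm_eq_abs, Real.norm_eq_abs,
        abs_of_nonneg (by linarith [hx.1] : 0 ≤ x - -1)] at h
      rw [iteratedDeriv_zero, Function.iterate_zero_apply]
      nlinarith [hx.2]

open Polynomial in
/-- If a function is uniformly close to a polynomial, its `L²` distance to another polynomial
is controlled by that of the first polynomial. -/
lemma integral_sub_eval_sq_le {g h : ℝ → ℝ} {P p : ℝ[X]} {ε : ℝ}
    (hg : ContinuousOn g (Set.Icc (-1) 1))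
    (hP : ∀ x ∈ Set.Icc (-1 : ℝ) 1, |g x - P.eval x| ≤ ε)
    (hh : ∀ x ∈ Set.Icc (-1 : ℝ) 1, h x = g x - p.eval x) :
    ∫ x in (-1 : ℝ)..1, h x ^ 2 ≤ 4 * ε ^ 2 + 2 * polyIntegral ((P - p) ^ 2) := by
  have e : 4 * ε ^ 2 + 2 * polyIntegral ((P - p) ^ 2) =
      polyIntegral (C (2 * ε ^ 2) + (2 : ℝ) • (P - p) ^ 2) := by
    have : polyIntegral (C (2 * ε ^ 2)) = 4 * ε ^ 2 := by
      rw [polyIntegral.apply_def]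
      simp only [eval_C, intervalIntegral.integral_const, smul_eq_mul]
      ring
    rw [map_add, map_smul, this, smul_eq_mul]
  rw [e, polyIntegral.apply_def]
  have hc : ContinuousOn (fun x => h x ^ 2) (Set.Icc (-1) 1) :=
    ((hg.sub p.continuous.continuousOn).congr hh).pow 2
  refine intervalIntegral.integral_mono_on (by norm_num)
    (ContinuousOn.intervalIntegrable_of_Icc (by norm_num) hc)
    ((Polynomial.continuous _).intervalIntegrable _ _) fun x hx => ?_
  have h1 : (g x - P.eval x) ^ 2 ≤ ε ^ 2 := by
    rw [← sq_abs]; exact pow_le_pow_left₀ (abs_nonneg _) (hP x hx) 2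
  simp only [hh x hx, eval_add, eval_C, eval_smul, eval_pow, eval_sub, smul_eq_mul]
  nlinarith [sq_nonneg ((g x - P.eval x) - (P.eval x - p.eval x))]

open Polynomial in
lemma H2norm_sub_le {f : ℝ → ℝ} {U : Set ℝ} (hU : IsOpen U)
    (hsub : Set.Icc (-1 : ℝ) 1 ⊆ U) (hf : ContDiffOn ℝ (⊤ : ℕ∞) f U) {P p : ℝ[X]} {ε S : ℝ}
    (hP : ∀ i ≤ 2, ∀ x ∈ Set.Icc (-1 : ℝ) 1,
      |iteratedDeriv i f x - (derivative^[i] P).eval x| ≤ ε)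
    (h0 : p.eval (-1) = P.eval (-1))
    (h1 : (derivative p).eval (-1) = (derivative P).eval (-1))
    (h2 : polyIntegral ((derivative (derivative P) - derivative (derivative p)) ^ 2) ≤ S) :
    H2norm (fun x => f x - p.eval x) ≤ √(12 * ε ^ 2 + 546 * S) := by
  have hf1 : ContDiffOn ℝ (⊤ : ℕ∞) (deriv f) U := hf.deriv_of_isOpen hU (by simp)
  have hf2 : ContDiffOn ℝ (⊤ : ℕ∞) (deriv (deriv f)) U := hf1.deriv_of_isOpen hU (by simp)
  have hd1 : ∀ x ∈ U, deriv (fun x => f x - p.eval x) x = deriv f x - (derivative p).eval x :=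
    fun x hx => by
      have := (hf.contDiffAt (hU.mem_nhds hx)).differentiableAt (by simp)
      exact (this.hasDerivAt.sub (p.hasDerivAt x)).deriv
  have hd2 : ∀ x ∈ U, deriv (deriv (fun x => f x - p.eval x)) x =
      deriv (deriv f) x - (derivative (derivative p)).eval x := fun x hx => by
    have := (hf1.contDiffAt (hU.mem_nhds hx)).differentiableAt (by simp)
    rw [(Filter.eventuallyEq_of_mem (hU.mem_nhds hx) hd1).deriv_eq]
    exact (this.hasDerivAt.sub ((derivative p).hasDerivAt x)).deriv
  have i0 := integral_sub_eval_sq_le (hf.continuousOn.mono hsub)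
    (fun x hx => by simpa using hP 0 (by norm_num) x hx)
    (h := fun x => f x - p.eval x) (p := p) (fun x _ => rfl)
  have i1 := integral_sub_eval_sq_le (hf1.continuousOn.mono hsub)
    (fun x hx => by simpa [iteratedDeriv_succ'] using hP 1 (by norm_num) x hx)
    (fun x hx => hd1 x (hsub hx))
  have i2 := integral_sub_eval_sq_le (hf2.continuousOn.mono hsub)
    (fun x hx => by simpa [iteratedDeriv_succ'] using hP 2 (by norm_num) x hx)
    (fun x hx => hd2 x (hsub hx))
  have j0 := polyIntegral.sq_le_derivative_sq (p := P - p) (by rw [eval_sub, h0, sub_self])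
  have j1 := polyIntegral.sq_le_derivative_sq (p := derivative P - derivative p)
    (by rw [eval_sub, h1, sub_self])
  rw [derivative_sub] at j0 j1
  exact Real.sqrt_le_sqrt (by linarith)

/-- There is a constant `C > 0` such that for every `δ ≥ 1`, `C_G, A > 0`,
every `f ∈ G^δ([-1,1], C_G, A)`, every integer `m ≥ 3` and every integer `k`
with `2 ≤ k ≤ m - 1`, there is a polynomial `p` of degree at most `m` with
`‖f - p‖_{H²([-1,1])} ≤ C·C_G·A^{k+2}·((k+2)!)^δ·((m-1-k)!/(m-1+k)!)^{1/2}`. -/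
theorem stmt11 :
    ∃ C : ℝ, 0 < C ∧
      ∀ δ CG A : ℝ, 1 ≤ δ → 0 < CG → 0 < A →
        ∀ f : ℝ → ℝ, GevreyOn (-1) 1 δ CG A f →
          ∀ m k : ℕ, 3 ≤ m → 2 ≤ k → k ≤ m - 1 →
            ∃ p : Polynomial ℝ, p.natDegree ≤ m ∧
              H2norm (fun x => f x - p.eval x) ≤
                C * CG * A ^ (k + 2) * ((k + 2).factorial : ℝ) ^ δ *
                  Real.sqrt (((m - 1 - k).factorial : ℝ) /
                    ((m - 1 + k).factorial : ℝ)) := by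
  refine ⟨100, by norm_num, fun δ CG A _ hCG hA f hf m k hm hk hkm => ?_⟩
  obtain ⟨⟨U, hU, hsub, hfU⟩, hbd⟩ := hf
  set M : ℝ := CG * A ^ (k + 2) * ((k + 2).factorial : ℝ) ^ δ with hM
  set R : ℝ := ((m - 1 - k).factorial : ℝ) / ((m - 1 + k).factorial : ℝ) with hR
  have hM0 : 0 < M := by positivity
  have hR0 : 0 < R := by positivity
  have hs0 : 0 < √R := Real.sqrt_pos.2 hR0
  obtain ⟨P, hP⟩ := exists_polynomial_near_iteratedDeriv hU hsub (k + 2) hfU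
    (ε := min M (M * √R)) (by positivity)
  obtain ⟨q, hq, hPq⟩ := polyIntegral.exists_approx
    (Polynomial.derivative (Polynomial.derivative P)) (m - 1) k hkm
  rw [← Function.iterate_succ_apply, ← Function.iterate_succ_apply] at hPq
  have hPk : ∀ x ∈ Set.Icc (-1 : ℝ) 1,
      |(Polynomial.derivative^[k + 2] P).eval x| ≤ 2 * M := fun x hx => by
    have h1 := (hP (k + 2) le_rfl x hx).trans (min_le_left _ _)
    have h2 := hbd (k + 2) x hx
    rw [abs_le] at h1 h2 ⊢
    constructor <;> linarith [h1.1, h1.2, h2.1, h2.2]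
  have hS := hPq.trans (mul_le_mul_of_nonneg_left (polyIntegral.weighted_self_le hPk) hR0.le)
  obtain ⟨p₁, rfl, hp₁⟩ := polyIntegral.exists_antiderivative q
    ((Polynomial.derivative P).eval (-1))
  obtain ⟨p, rfl, hp⟩ := polyIntegral.exists_antiderivative p₁ (P.eval (-1))
  have hdeg := polyIntegral.degree_lt_of_derivative (polyIntegral.degree_lt_of_derivative hq)
  rw [show m - 1 + 1 + 1 = m + 1 by omega] at hdeg
  refine ⟨p, ?_, ?_⟩
  · exact Polynomial.natDegree_le_iff_coeff_eq_zero.2 fun e he =>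
      (Polynomial.degree_lt_iff_coeff_zero _ _).1 hdeg e he
  · refine (H2norm_sub_le hU hsub hfU
      (fun i hi x hx => (hP i (by omega) x hx).trans (min_le_right _ _)) hp hp₁ hS).trans ?_
    have e : 100 * CG * A ^ (k + 2) * ((k + 2).factorial : ℝ) ^ δ * √R = 100 * M * √R := by
      rw [hM]; ring
    rw [e, Real.sqrt_le_left (by positivity)]
    nlinarith [Real.sq_sqrt hR0.le, mul_pos (pow_pos hM0 2) hR0]
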